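/- arXiv:1102.1759 — 2 statements merged into one kernel-verified Lean document; each statement's English description precedes it below -/
import Mathlib

section
/- Let n ≥ 1 be an integer, δ ∈ (0,1], C ≥ 0, and let Q assign to each x ∈ ℂⁿ \ {0} a function Q(x) : ℂⁿ → ℝ such that Q(x)(v) ≥ 0 for all v, Q(x)(c·v) = |c|²·Q(x)(v) for all complex scalars c, and such that x ↦ Q(x)(v) is continuous on ℂⁿ \ {0} for each fixed v. Assume Q(x)(x) ≤ C·‖x‖^(2δ) for all x ≠ 0. Then for every z ∈ ℂⁿ \ {0} and every θ ∈ [0, 2π], the path γ(s) = exp(i·s·θ)·z, s ∈ [0,1], has length at most θ·√C·‖z‖^δ, i.e. ∫₀¹ √(Q(γ(s))(γ'(s))) ds ≤ θ·√C·‖z‖^δ, where γ'(s) = i·θ·exp(i·s·θ)·z. -/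
/-- under the radial bound Q(x)(x) ≤ C‖x‖^(2δ), the circular path
γ(s) = e^{isθ}·z has length ∫₀¹ √(Q(γ(s))(γ'(s))) ds ≤ θ·√C·‖z‖^δ
(Lemma 5.3 of the paper). -/
theorem stmt_9 (n : ℕ) (hn : 1 ≤ n) (δ C : ℝ) (hδ : 0 < δ) (hδ1 : δ ≤ 1)
    (hC : 0 ≤ C)
    (Q : EuclideanSpace ℂ (Fin n) → EuclideanSpace ℂ (Fin n) → ℝ)
    (hQ0 : ∀ x, x ≠ 0 → ∀ v, 0 ≤ Q x v)
    (hQhom : ∀ x, x ≠ 0 → ∀ (c : ℂ) (v), Q x (c • v) = ‖c‖ ^ 2 * Q x v)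
    (hQcont : ∀ v, ContinuousOn (fun x => Q x v) {x | x ≠ 0})
    (hQbound : ∀ x, x ≠ 0 → Q x x ≤ C * ‖x‖ ^ (2 * δ))
    (z : EuclideanSpace ℂ (Fin n)) (hz : z ≠ 0)
    (θ : ℝ) (hθ0 : 0 ≤ θ) (hθ : θ ≤ 2 * Real.pi) :
    ∫ s in (0 : ℝ)..1,
        Real.sqrt (Q (Complex.exp (Complex.I * s * θ) • z)
          ((Complex.I * θ * Complex.exp (Complex.I * s * θ)) • z)) ≤
      θ * Real.sqrt C * ‖z‖ ^ δ := by
  have hspeed : ∀ s ∈ Set.uIoc (0 : ℝ) 1,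
      ‖Real.sqrt (Q (Complex.exp (Complex.I * s * θ) • z)
          ((Complex.I * θ * Complex.exp (Complex.I * s * θ)) • z))‖ ≤
        θ * Real.sqrt C * ‖z‖ ^ δ := by
    intro s _
    set w := Complex.exp (Complex.I * s * θ) • z with hw
    have hw0 : w ≠ 0 := smul_ne_zero (Complex.exp_ne_zero _) hz
    have hexp : ‖Complex.exp (Complex.I * s * θ)‖ = 1 := by
      simp [Complex.norm_exp]
    have hnorm : ‖w‖ = ‖z‖ := by rw [hw, norm_smul, hexp, one_mul]
    have hc : ‖Complex.I * (θ : ℂ)‖ = θ := by simp [abs_of_nonneg hθ0]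
    have hrpow : ‖z‖ ^ (2 * δ) = (‖z‖ ^ δ) ^ 2 := by
      rw [mul_comm, Real.rpow_mul (norm_nonneg z), Real.rpow_two]
    rw [mul_smul, ← hw, hQhom w hw0, hc, Real.norm_of_nonneg (Real.sqrt_nonneg _)]
    refine Real.sqrt_le_iff.mpr ⟨by positivity, ?_⟩
    calc θ ^ 2 * Q w w ≤ θ ^ 2 * (C * (‖z‖ ^ δ) ^ 2) := by
          gcongr
          simpa only [hnorm, hrpow] using hQbound w hw0
      _ = (θ * Real.sqrt C * ‖z‖ ^ δ) ^ 2 := by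
          rw [mul_pow, mul_pow, Real.sq_sqrt hC]
          ring
  have hlength := intervalIntegral.norm_integral_le_of_norm_le_const hspeed
  rw [sub_zero, abs_one, mul_one] at hlength
  exact (Real.le_norm_self _).trans hlength
end

section
/- Let r > 0 and let θ, η ∈ [0, π/6]. In ℂ², define L = { (2r·cos θ, w) : w ∈ ℂ } and 𝒞 = { (ρ·e^{iξ₁}·cos t, ρ·e^{iξ₂}·sin t) : ρ ≥ 0, ξ₁, ξ₂ ∈ ℝ, t ∈ [0, η] }. Then L ∩ 𝒞 = { (2r·cos θ, w) : w ∈ ℂ, |w| ≤ 2r·cos θ·tan η }, and every z ∈ L ∩ 𝒞 satisfies √3·r ≤ ‖z‖ ≤ (4/√3)·r; in particular L ∩ 𝒞 is contained in the annulus { z ∈ ℂ² : r ≤ ‖z‖ ≤ 4r }. -/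
open Real

theorem norm_ofReal_mul_exp_I_mul_mul {ρ x : ℝ} (hρ : 0 ≤ ρ) (hx : 0 ≤ x) (ξ : ℝ) :
    ‖(ρ : ℂ) * Complex.exp (Complex.I * (ξ : ℂ)) * (x : ℂ)‖ = ρ * x := by
  rw [norm_mul, norm_mul, Complex.norm_exp_I_mul_ofReal, Complex.norm_of_nonneg hρ,
    Complex.norm_of_nonneg hx, mul_one]

/-- A point `(a, w)` with `a > 0` lies in the cone of opening angle `η` if and only if
`‖w‖ ≤ a * tan η`. -/
theorem exists_polar_iff_norm_le_mul_tan {a η : ℝ} (ha : 0 < a) (hη₀ : 0 ≤ η) (hη : η < π / 2)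
    (w : ℂ) :
    (∃ ρ : ℝ, 0 ≤ ρ ∧ ∃ ξ₁ ξ₂ : ℝ, ∃ t ∈ Set.Icc 0 η,
      (a : ℂ) = (ρ : ℂ) * Complex.exp (Complex.I * (ξ₁ : ℂ)) * ((Real.cos t : ℝ) : ℂ) ∧
      w = (ρ : ℂ) * Complex.exp (Complex.I * (ξ₂ : ℂ)) * ((Real.sin t : ℝ) : ℂ)) ↔
      ‖w‖ ≤ a * Real.tan η := by
  constructor
  · rintro ⟨ρ, hρ, ξ₁, ξ₂, t, ⟨ht₀, ht⟩, h₀, rfl⟩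
    have hcos : 0 < Real.cos t := Real.cos_pos_of_mem_Ioo ⟨by linarith, by linarith⟩
    have hsin : 0 ≤ Real.sin t := Real.sin_nonneg_of_nonneg_of_le_pi ht₀ (by linarith)
    have h := congrArg norm h₀
    rw [norm_ofReal_mul_exp_I_mul_mul hρ hcos.le, Complex.norm_of_nonneg ha.le] at h
    have htan : Real.tan t ≤ Real.tan η :=
      Real.strictMonoOn_tan.monotoneOn ⟨by linarith, by linarith⟩ ⟨by linarith, hη⟩ ht
    calc _ = ρ * Real.sin t := norm_ofReal_mul_exp_I_mul_mul hρ hsin ξ₂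
      _ = a * Real.tan t := by rw [h, mul_assoc, mul_comm (Real.cos t), Real.tan_mul_cos hcos.ne']
      _ ≤ a * Real.tan η := by gcongr
  · intro hw
    set t := Real.arctan (‖w‖ / a) with ht
    have hcos : 0 < Real.cos t := Real.cos_arctan_pos _
    have htη : t ≤ η := by
      rw [← Real.arctan_tan (by linarith) hη]
      exact Real.arctan_mono ((div_le_iff₀' ha).2 hw)
    refine ⟨a / Real.cos t, by positivity, 0, w.arg, t,
      ⟨Real.arctan_nonneg.2 (by positivity), htη⟩, ?_, ?_⟩
    · rw [Complex.ofReal_zero, mul_zero, Complex.exp_zero, mul_one, ← Complex.ofReal_mul,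
        div_mul_cancel₀ _ hcos.ne']
    · have hs : a / Real.cos t * Real.sin t = ‖w‖ := by
        rw [div_mul_eq_mul_div, mul_div_assoc, ← Real.tan_eq_sin_div_cos, ht, Real.tan_arctan,
          mul_div_cancel₀ _ ha.ne']
      rw [mul_right_comm, ← Complex.ofReal_mul, hs, mul_comm Complex.I,
        Complex.norm_mul_exp_arg_mul_I]

/-- in ℂ², the slice L̃ = L ∩ 𝒞 of the cone 𝒞 (opening angle η)
by the complex line L = {z¹ = 2r cos θ} is the closed disk of radius
2r·cos θ·tan η, and it lies in the annulus {√3·r ≤ ‖z‖ ≤ (4/√3)·r} ⊆ A_{r,4r}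
(the unnumbered lemma in Section 5 of the paper). -/
theorem stmt_13 (r θ η : ℝ) (hr : 0 < r)
    (hθ : θ ∈ Set.Icc 0 (π / 6)) (hη : η ∈ Set.Icc 0 (π / 6))
    (L C : Set (EuclideanSpace ℂ (Fin 2)))
    (hL : L = {z | z 0 = ((2 * r * Real.cos θ : ℝ) : ℂ)})
    (hC : C = {z | ∃ ρ : ℝ, 0 ≤ ρ ∧ ∃ ξ₁ ξ₂ : ℝ, ∃ t ∈ Set.Icc 0 η,
      z 0 = (ρ : ℂ) * Complex.exp (Complex.I * (ξ₁ : ℂ)) * ((Real.cos t : ℝ) : ℂ) ∧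
      z 1 = (ρ : ℂ) * Complex.exp (Complex.I * (ξ₂ : ℂ)) * ((Real.sin t : ℝ) : ℂ)}) :
    L ∩ C = {z | z 0 = ((2 * r * Real.cos θ : ℝ) : ℂ) ∧
        ‖z 1‖ ≤ 2 * r * Real.cos θ * Real.tan η} ∧
      (∀ z ∈ L ∩ C, Real.sqrt 3 * r ≤ ‖z‖ ∧ ‖z‖ ≤ 4 / Real.sqrt 3 * r) ∧
      (∀ z ∈ L ∩ C, r ≤ ‖z‖ ∧ ‖z‖ ≤ 4 * r) := by
  obtain ⟨hθ₀, hθ₁⟩ := hθ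
  obtain ⟨hη₀, hη₁⟩ := hη
  have hπ := Real.pi_pos
  have hcos : √3 / 2 ≤ Real.cos θ := by
    rw [← Real.cos_pi_div_six]
    exact Real.cos_le_cos_of_nonneg_of_le_pi hθ₀ (by linarith) hθ₁
  have hcos₁ : Real.cos θ ≤ 1 := Real.cos_le_one θ
  have h3 : √3 ^ 2 = 3 := Real.sq_sqrt (by norm_num)
  have h3pos : 0 < √3 := by positivity
  have htan₀ : 0 ≤ Real.tan η := Real.tan_nonneg_of_nonneg_of_le_pi_div_two hη₀ (by linarith)
  have htan : Real.tan η ≤ 1 / √3 := by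
    rw [← Real.tan_pi_div_six]
    exact Real.strictMonoOn_tan.monotoneOn ⟨by linarith, by linarith⟩
      ⟨by linarith, by linarith⟩ hη₁
  set a := 2 * r * Real.cos θ with ha
  have ha_lower : √3 * r ≤ a := by nlinarith
  have ha_upper : a ≤ 2 * r := by nlinarith
  have ha_pos : 0 < a := lt_of_lt_of_le (by positivity) ha_lower
  have hLC : L ∩ C = {z | z 0 = (a : ℂ) ∧ ‖z 1‖ ≤ a * Real.tan η} := by
    ext z
    simp only [hL, hC, Set.mem_inter_iff, Set.mem_ofPred_eq]
    refine and_congr_right fun h₀ => ?_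
    rw [h₀]
    exact exists_polar_iff_norm_le_mul_tan ha_pos hη₀ (by linarith) (z 1)
  have hbound : ∀ z ∈ L ∩ C, √3 * r ≤ ‖z‖ ∧ ‖z‖ ≤ 4 / √3 * r := by
    intro z hz
    rw [hLC] at hz
    obtain ⟨h₀, h₁⟩ := hz
    have hnorm : ‖z‖ ^ 2 = a ^ 2 + ‖z 1‖ ^ 2 := by
      rw [EuclideanSpace.norm_sq_eq, Fin.sum_univ_two, h₀, Complex.norm_of_nonneg ha_pos.le]
    have hw : ‖z 1‖ ≤ 2 * r * (1 / √3) := h₁.trans (by gcongr)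
    constructor
    · refine ha_lower.trans (le_of_sq_le_sq ?_ (norm_nonneg z))
      rw [hnorm]
      exact le_add_of_nonneg_right (sq_nonneg _)
    · refine le_of_sq_le_sq ?_ (by positivity)
      calc ‖z‖ ^ 2 = a ^ 2 + ‖z 1‖ ^ 2 := hnorm
        _ ≤ (2 * r) ^ 2 + (2 * r * (1 / √3)) ^ 2 := by gcongr
        _ = (4 / √3 * r) ^ 2 := by
          simp only [mul_pow, div_pow, h3]
          ring
  refine ⟨hLC, hbound, fun z hz => ?_⟩
  obtain ⟨hl, hu⟩ := hbound z hz
  have h1 : 1 ≤ √3 := Real.one_le_sqrt.2 (by norm_num)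
  exact ⟨(le_mul_of_one_le_left hr.le h1).trans hl,
    hu.trans (mul_le_mul_of_nonneg_right (div_le_self (by norm_num) h1) hr.le)⟩
end
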